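/- Let P = (1/100)·P₁ + (99/100)·P₂ where P₁ is uniform on [0,1/3] and P₂ is uniform on [2/3,1]. For n ≥ 3, if γ_n is an optimal set of n-means and k = card(γ_n ∩ [0,1/3]), then 1 ≤ k ≤ n−1, γ_n equals the union of an optimal set of k-means for P₁ and an optimal set of (n−k)-means for P₂, and V_n(P) = (1/10800)·(1/k² + 99/(n−k)²). -/

import Mathlib

open MeasureTheory Set

noncomputable def unif (a b : ℝ) : Measure ℝ :=
  (ENNReal.ofReal (b - a))⁻¹ • (volume.restrict (Icc a b))

noncomputable def mix (p : ℝ) (P₁ P₂ : Measure ℝ) : Measure ℝ :=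
  ENNReal.ofReal p • P₁ + ENNReal.ofReal (1 - p) • P₂

noncomputable def distortion (P : Measure ℝ) (γ : Finset ℝ) : ℝ :=
  ∫ x, sInf ((fun c => (x - c) ^ 2) '' (γ : Set ℝ)) ∂P

noncomputable def quantErr (P : Measure ℝ) (n : ℕ) : ℝ :=
  sInf { v | ∃ γ : Finset ℝ, γ.Nonempty ∧ γ.card ≤ n ∧ v = distortion P γ }

def IsOptimal (P : Measure ℝ) (n : ℕ) (γ : Finset ℝ) : Prop :=
  γ.Nonempty ∧ γ.card ≤ n ∧ distortion P γ = quantErr P n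

/-- The squared distance from `x` to the finite set `γ`. -/
noncomputable def sqDist (γ : Finset ℝ) (x : ℝ) : ℝ :=
  sInf ((fun c => (x - c) ^ 2) '' (γ : Set ℝ))

/-- The unnormalized distortion of `γ` on the interval `[a, b]`. -/
noncomputable def intervalCost (γ : Finset ℝ) (a b : ℝ) : ℝ :=
  ∫ x in Icc a b, sqDist γ x

theorem sqDist_eq_inf' {γ : Finset ℝ} (hγ : γ.Nonempty) (x : ℝ) :
    sqDist γ x = γ.inf' hγ (fun c => (x - c) ^ 2) :=
  (Finset.inf'_eq_csInf_image γ hγ _).symm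

theorem sqDist_le {γ : Finset ℝ} {c : ℝ} (hc : c ∈ γ) (x : ℝ) : sqDist γ x ≤ (x - c) ^ 2 := by
  rw [sqDist_eq_inf' ⟨c, hc⟩]
  exact Finset.inf'_le _ hc

theorem exists_sqDist_eq {γ : Finset ℝ} (hγ : γ.Nonempty) (x : ℝ) :
    ∃ c ∈ γ, sqDist γ x = (x - c) ^ 2 := by
  rw [sqDist_eq_inf' hγ]
  exact Finset.exists_mem_eq_inf' hγ _

theorem le_sqDist {γ : Finset ℝ} (hγ : γ.Nonempty) {x r : ℝ} (h : ∀ c ∈ γ, r ≤ (x - c) ^ 2) :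
    r ≤ sqDist γ x := by
  obtain ⟨c, hc, e⟩ := exists_sqDist_eq hγ x
  exact e ▸ h c hc

theorem continuous_sqDist {γ : Finset ℝ} (hγ : γ.Nonempty) : Continuous (sqDist γ) := by
  rw [show sqDist γ = fun x => γ.inf' hγ (fun c => (x - c) ^ 2) from funext (sqDist_eq_inf' hγ)]
  exact Continuous.finset_inf'_apply hγ fun c _ => by fun_prop

theorem sqDist_anti {γ δ : Finset ℝ} (hγ : γ.Nonempty) (h : γ ⊆ δ) (x : ℝ) :
    sqDist δ x ≤ sqDist γ x :=
  le_sqDist hγ fun _ hc => sqDist_le (h hc) x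

theorem Continuous.integrableOn_Icc' {f : ℝ → ℝ} (hf : Continuous f) (a b : ℝ) :
    Integrable f (volume.restrict (Icc a b)) :=
  hf.continuousOn.integrableOn_Icc

theorem integral_Icc_eq {f : ℝ → ℝ} {a b : ℝ} (h : a ≤ b) :
    ∫ x in Icc a b, f x = ∫ x in a..b, f x := by
  rw [intervalIntegral.integral_of_le h, integral_Icc_eq_integral_Ioc]

theorem integral_sub_sq (a b c : ℝ) :
    ∫ x in a..b, (x - c) ^ 2 = ((b - c) ^ 3 - (a - c) ^ 3) / 3 := by
  rw [intervalIntegral.integral_comp_sub_right (fun x => x ^ 2) c, integral_pow]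
  norm_num

theorem intervalCost_mono_of_le {γ : Finset ℝ} (hγ : γ.Nonempty) {f : ℝ → ℝ} (hf : Continuous f)
    {a b : ℝ} (h : ∀ x ∈ Icc a b, f x ≤ sqDist γ x) :
    ∫ x in Icc a b, f x ≤ intervalCost γ a b :=
  setIntegral_mono_on (hf.integrableOn_Icc' a b) ((continuous_sqDist hγ).integrableOn_Icc' a b)
    measurableSet_Icc h

theorem distortion_unif (γ : Finset ℝ) {a b : ℝ} (h : a < b) :
    distortion (unif a b) γ = (b - a)⁻¹ * intervalCost γ a b := by
  have : 0 ≤ b - a := by linarith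
  simp [distortion, unif, intervalCost, sqDist, integral_smul_measure, ENNReal.toReal_ofReal this]

theorem integrable_unif {γ : Finset ℝ} (hγ : γ.Nonempty) {a b : ℝ} (h : a < b) :
    Integrable (sqDist γ) (unif a b) := by
  refine ((continuous_sqDist hγ).integrableOn_Icc' a b).smul_measure ?_
  simpa using h

theorem distortion_mix {γ : Finset ℝ} (hγ : γ.Nonempty) {a b c d p : ℝ} (hab : a < b)
    (hcd : c < d) (hp₀ : 0 ≤ p) (hp₁ : p ≤ 1) :
    distortion (mix p (unif a b) (unif c d)) γ
      = p * distortion (unif a b) γ + (1 - p) * distortion (unif c d) γ := by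
  have h₁ := (integrable_unif hγ hab).smul_measure (c := ENNReal.ofReal p) ENNReal.ofReal_ne_top
  have h₂ := (integrable_unif hγ hcd).smul_measure (c := ENNReal.ofReal (1 - p))
    ENNReal.ofReal_ne_top
  have := integral_add_measure h₁ h₂
  rw [integral_smul_measure, integral_smul_measure, ENNReal.toReal_ofReal hp₀,
    ENNReal.toReal_ofReal (sub_nonneg.2 hp₁)] at this
  exact this

theorem quantErr_le (P : Measure ℝ) {n : ℕ} {γ : Finset ℝ} (hγ : γ.Nonempty) (h : γ.card ≤ n) :
    quantErr P n ≤ distortion P γ := by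
  refine csInf_le ⟨0, ?_⟩ ⟨γ, hγ, h, rfl⟩
  rintro _ ⟨δ, hδ, -, rfl⟩
  exact integral_nonneg fun x => le_sqDist hδ fun c _ => sq_nonneg (x - c)

theorem le_quantErr {P : Measure ℝ} {n : ℕ} (hn : 0 < n) {r : ℝ}
    (h : ∀ γ : Finset ℝ, γ.Nonempty → γ.card ≤ n → r ≤ distortion P γ) : r ≤ quantErr P n := by
  refine le_csInf ⟨_, {0}, by simp, (Finset.card_singleton _).trans_le hn, rfl⟩ ?_
  rintro _ ⟨γ, h₁, h₂, rfl⟩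
  exact h γ h₁ h₂

/-- The nonnegative bump of height `h ^ 2` supported on `[c - h, c + h]`. -/
noncomputable def bump (h c x : ℝ) : ℝ := max (h ^ 2 - (x - c) ^ 2) 0

theorem continuous_bump (h c : ℝ) : Continuous (bump h c) := by
  unfold bump
  fun_prop

theorem integral_bump_le_of_subset {h c a b s t : ℝ} (hst : s ≤ t) (h₁ : c - h ≤ s)
    (h₂ : t ≤ c + h) (hsub : ∀ x ∈ Icc a b, 0 < bump h c x → x ∈ Icc s t) :
    ∫ x in Icc a b, bump h c x ≤ ∫ x in s..t, (h ^ 2 - (x - c) ^ 2) := by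
  have hnn : ∀ x ∈ Icc s t, 0 ≤ h ^ 2 - (x - c) ^ 2 := fun x hx => by
    nlinarith [hx.1, hx.2]
  have hle : ∫ x in Icc a b, bump h c x
      ≤ ∫ x in Icc a b, (Icc s t).indicator (bump h c) x := by
    refine (setIntegral_congr_fun measurableSet_Icc fun x hx => ?_).le
    by_cases hx' : x ∈ Icc s t
    · simp [hx']
    · have h0 : 0 ≤ bump h c x := le_max_right _ _
      have : ¬ 0 < bump h c x := fun h' => hx' (hsub x hx h')
      simp only [indicator_of_notMem hx']
      linarith
  refine hle.trans ?_
  rw [setIntegral_indicator measurableSet_Icc, ← integral_Icc_eq hst]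
  refine (setIntegral_mono_set ((continuous_bump h c).integrableOn_Icc' s t)
    (Filter.Eventually.of_forall fun x => le_max_right _ _)
    (Filter.Eventually.of_forall fun x hx => hx.2)).trans ?_
  exact (setIntegral_congr_fun measurableSet_Icc fun x hx => max_eq_left (hnn x hx)).le

theorem integral_sq_sub_sq (h c s t : ℝ) :
    ∫ x in s..t, (h ^ 2 - (x - c) ^ 2)
      = h ^ 2 * (t - s) - ((t - c) ^ 3 - (s - c) ^ 3) / 3 := by
  rw [intervalIntegral.integral_sub (by simp) (Continuous.intervalIntegrable (by fun_prop) _ _),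
    integral_sub_sq, intervalIntegral.integral_const, smul_eq_mul]
  ring

theorem abs_lt_of_bump_pos {h c x : ℝ} (hh : 0 ≤ h) (hx : 0 < bump h c x) : |x - c| < h := by
  have : 0 < h ^ 2 - (x - c) ^ 2 := by
    simpa [bump] using hx
  exact abs_lt_of_sq_lt_sq (by linarith) hh

theorem integral_bump_le {h : ℝ} (hh : 0 ≤ h) (c a b : ℝ) :
    ∫ x in Icc a b, bump h c x ≤ 4 / 3 * h ^ 3 := by
  refine (integral_bump_le_of_subset (s := c - h) (t := c + h) (by linarith) le_rfl le_rfl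
    fun x _ hx => ?_).trans (le_of_eq ?_)
  · have := abs_lt.1 (abs_lt_of_bump_pos hh hx)
    constructor <;> linarith [this.1, this.2]
  · rw [integral_sq_sub_sq]
    ring

theorem integral_bump_le_of_notMem {h : ℝ} (hh : 0 ≤ h) {c a b : ℝ} (hc : c ∉ Icc a b) :
    ∫ x in Icc a b, bump h c x ≤ 2 / 3 * h ^ 3 := by
  rcases lt_or_ge c a with hca | hca
  · refine (integral_bump_le_of_subset (s := c) (t := c + h) (by linarith) (by linarith) le_rfl
      fun x hx' hx => ?_).trans (le_of_eq ?_)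
    · have := abs_lt.1 (abs_lt_of_bump_pos hh hx)
      constructor <;> linarith [this.1, this.2, hx'.1]
    · rw [integral_sq_sub_sq]
      ring
  · have hcb : b < c := lt_of_not_ge fun h' => hc ⟨hca, h'⟩
    refine (integral_bump_le_of_subset (s := c - h) (t := c) (by linarith) le_rfl (by linarith)
      fun x hx' hx => ?_).trans (le_of_eq ?_)
    · have := abs_lt.1 (abs_lt_of_bump_pos hh hx)
      constructor <;> linarith [this.1, this.2, hx'.2]
    · rw [integral_sq_sub_sq]
      ring

theorem sub_sum_integral_bump_le {γ S : Finset ℝ} (hγ : γ.Nonempty) {a b h : ℝ} (hab : a ≤ b)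
    (hh : 0 ≤ h) (hS : ∀ c ∈ γ, c ∈ S ∨ ∀ x ∈ Icc a b, h ≤ |x - c|) :
    (b - a) * h ^ 2 - ∑ c ∈ S, ∫ x in Icc a b, bump h c x ≤ intervalCost γ a b := by
  have hcont : Continuous fun x => h ^ 2 - ∑ c ∈ S, bump h c x :=
    continuous_const.sub (continuous_finsetSum _ fun c _ => continuous_bump h c)
  have hnn : ∀ c x, 0 ≤ bump h c x := fun c x => le_max_right _ _
  have key := intervalCost_mono_of_le hγ hcont (a := a) (b := b) fun x hx =>
    le_sqDist hγ fun c hc => by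
      rcases hS c hc with h' | h'
      · have h₁ := Finset.single_le_sum (fun c _ => hnn c x) h'
        have h₂ : h ^ 2 - (x - c) ^ 2 ≤ bump h c x := le_max_left _ _
        linarith
      · have h₁ : 0 ≤ ∑ c ∈ S, bump h c x := Finset.sum_nonneg fun c _ => hnn c x
        have h₂ : h ^ 2 ≤ |x - c| ^ 2 := pow_le_pow_left₀ hh (h' x hx) 2
        rw [sq_abs] at h₂
        linarith
  refine le_trans (le_of_eq ?_) key
  rw [integral_sub (continuous_const.integrableOn_Icc' a b) ((continuous_finsetSum _
    fun c _ => continuous_bump h c).integrableOn_Icc' a b),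
    integral_finsetSum _ fun c _ => (continuous_bump h c).integrableOn_Icc' a b]
  simp [hab]

/-- Lower bound for the distortion on an interval when at most `m` of the points come close. -/
theorem le_intervalCost {γ S : Finset ℝ} (hγ : γ.Nonempty) {a b : ℝ} (hab : a ≤ b) {m : ℕ}
    (hm : 0 < m) (hcard : S.card ≤ m)
    (hS : ∀ c ∈ γ, c ∈ S ∨ ∀ x ∈ Icc a b, (b - a) / (2 * m) ≤ |x - c|) :
    (b - a) ^ 3 / (12 * (m : ℝ) ^ 2) ≤ intervalCost γ a b := by
  have hm' : (0 : ℝ) < m := by exact_mod_cast hm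
  have hh : 0 ≤ (b - a) / (2 * m) := div_nonneg (by linarith) (by positivity)
  refine le_trans ?_ (sub_sum_integral_bump_le hγ hab hh hS)
  have h₁ := Finset.sum_le_card_nsmul S _ _ fun c _ => integral_bump_le hh c a b
  rw [nsmul_eq_mul] at h₁
  have h₂ : (S.card : ℝ) * (4 / 3 * ((b - a) / (2 * m)) ^ 3)
      ≤ m * (4 / 3 * ((b - a) / (2 * m)) ^ 3) := by
    gcongr
  have h₃ : (b - a) * ((b - a) / (2 * m)) ^ 2 - m * (4 / 3 * ((b - a) / (2 * m)) ^ 3)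
      = (b - a) ^ 3 / (12 * (m : ℝ) ^ 2) := by
    field_simp
    ring
  linarith

/-- If the lower bound `le_intervalCost` is attained, the close points lie in the interval. -/
theorem mem_Icc_of_intervalCost_le {γ S : Finset ℝ} (hγ : γ.Nonempty) {a b : ℝ} (hab : a < b)
    {m : ℕ} (hm : 0 < m) (hcard : S.card ≤ m)
    (hS : ∀ c ∈ γ, c ∈ S ∨ ∀ x ∈ Icc a b, (b - a) / (2 * m) ≤ |x - c|)
    (hcost : intervalCost γ a b ≤ (b - a) ^ 3 / (12 * (m : ℝ) ^ 2)) :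
    ∀ c ∈ S, c ∈ Icc a b := by
  intro c hc
  by_contra hcn
  have hm' : (0 : ℝ) < m := by exact_mod_cast hm
  have hh : 0 < (b - a) / (2 * m) := div_pos (by linarith) (by positivity)
  have h₀ := sub_sum_integral_bump_le hγ hab.le hh.le hS
  rw [← Finset.add_sum_erase S _ hc] at h₀
  have h₁ := Finset.sum_le_card_nsmul (S.erase c) _ _ fun c _ => integral_bump_le hh.le c a b
  have h₂ := integral_bump_le_of_notMem hh.le hcn
  have h₄ : ((S.erase c).card : ℝ) + 1 ≤ m := by
    have := Finset.card_erase_add_one hc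
    exact_mod_cast this.trans_le hcard
  rw [nsmul_eq_mul] at h₁
  have h₅ : ((S.erase c).card : ℝ) * (4 / 3 * ((b - a) / (2 * m)) ^ 3)
      ≤ (m - 1) * (4 / 3 * ((b - a) / (2 * m)) ^ 3) := by
    gcongr
    linarith
  have h₃ : (b - a) * ((b - a) / (2 * m)) ^ 2 - m * (4 / 3 * ((b - a) / (2 * m)) ^ 3)
      = (b - a) ^ 3 / (12 * (m : ℝ) ^ 2) := by
    field_simp
    ring
  have h₆ : 0 < ((b - a) / (2 * m)) ^ 3 := by positivity
  linarith

/-- The midpoints of the `m` equal subintervals of `[a, b]`. -/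
noncomputable def midpoints (a b : ℝ) (m : ℕ) : Finset ℝ :=
  (Finset.range m).image fun i : ℕ => a + (2 * i + 1) * ((b - a) / (2 * m))

theorem midpoints_nonempty (a b : ℝ) {m : ℕ} (hm : 0 < m) : (midpoints a b m).Nonempty :=
  (Finset.nonempty_range_iff.2 hm.ne').image _

theorem card_midpoints_le (a b : ℝ) (m : ℕ) : (midpoints a b m).card ≤ m :=
  Finset.card_image_le.trans (Finset.card_range m).le

theorem intervalCost_le_of_midpoints_subset {a b : ℝ} (hab : a ≤ b) {m : ℕ} (hm : 0 < m)
    {γ : Finset ℝ} (hγ : midpoints a b m ⊆ γ) :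
    intervalCost γ a b ≤ (b - a) ^ 3 / (12 * (m : ℝ) ^ 2) := by
  have hm' : (0 : ℝ) < m := by exact_mod_cast hm
  have hcont := continuous_sqDist ((midpoints_nonempty a b hm).mono hγ)
  set h := (b - a) / (2 * m) with hh
  have hh0 : 0 ≤ h := div_nonneg (by linarith) (by positivity)
  have hmh : a + 2 * m * h = b := by
    rw [hh]
    field_simp
    ring
  have hsum := intervalIntegral.sum_integral_adjacent_intervals (f := sqDist γ) (μ := volume)
    (a := fun i : ℕ => a + 2 * i * h) (n := m) fun i _ => hcont.intervalIntegrable _ _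
  have hterm : ∀ i ∈ Finset.range m,
      ∫ x in (a + 2 * (i : ℕ) * h)..(a + 2 * ((i + 1 : ℕ) : ℝ) * h), sqDist γ x
        ≤ 2 / 3 * h ^ 3 := by
    intro i hi
    have hle : a + 2 * (i : ℝ) * h ≤ a + 2 * ((i + 1 : ℕ) : ℝ) * h := by
      push_cast
      linarith
    refine (intervalIntegral.integral_mono_on hle (hcont.intervalIntegrable _ _)
      (Continuous.intervalIntegrable (by fun_prop) _ _) fun x _ =>
        sqDist_le (hγ (Finset.mem_image_of_mem _ hi)) x).trans (le_of_eq ?_)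
    rw [integral_sub_sq]
    push_cast
    ring
  have h₁ := Finset.sum_le_card_nsmul _ _ _ hterm
  rw [hsum, Finset.card_range, nsmul_eq_mul] at h₁
  simp only [Nat.cast_zero, mul_zero, zero_mul, add_zero, hmh] at h₁
  rw [intervalCost, integral_Icc_eq hab]
  refine h₁.trans (le_of_eq ?_)
  rw [hh]
  field_simp
  ring

theorem quantErr_unif_eq {a b : ℝ} (hab : a < b) {m : ℕ} (hm : 0 < m) :
    quantErr (unif a b) m = (b - a) ^ 2 / (12 * (m : ℝ) ^ 2) := by
  have hm' : (0 : ℝ) < m := by exact_mod_cast hm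
  have hba : 0 < b - a := by linarith
  have e : (b - a) ^ 2 / (12 * (m : ℝ) ^ 2) = (b - a)⁻¹ * ((b - a) ^ 3 / (12 * (m : ℝ) ^ 2)) := by
    field_simp
  refine le_antisymm ?_ (le_quantErr hm fun γ hγ hc => ?_)
  · refine (quantErr_le _ (midpoints_nonempty a b hm) (card_midpoints_le a b m)).trans ?_
    rw [distortion_unif _ hab, e]
    gcongr
    exact intervalCost_le_of_midpoints_subset hab.le hm subset_rfl
  · rw [distortion_unif _ hab, e]
    gcongr
    exact le_intervalCost hγ hab.le hm hc fun c hc => .inl hc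

theorem distortion_mix_eq_intervalCost {γ : Finset ℝ} (hγ : γ.Nonempty) :
    distortion (mix (1/100) (unif 0 (1/3)) (unif (2/3) 1)) γ
      = 3 / 100 * intervalCost γ 0 (1/3) + 297 / 100 * intervalCost γ (2/3) 1 := by
  rw [distortion_mix hγ (by norm_num) (by norm_num) (by norm_num) (by norm_num),
    distortion_unif _ (by norm_num), distortion_unif _ (by norm_num)]
  ring

theorem quantErr_mix_le {k l n : ℕ} (hk : 0 < k) (hl : 0 < l) (h : k + l ≤ n) :
    quantErr (mix (1/100) (unif 0 (1/3)) (unif (2/3) 1)) n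
      ≤ 1 / 10800 * (1 / (k : ℝ) ^ 2 + 99 / (l : ℝ) ^ 2) := by
  have hne : (midpoints 0 (1/3) k ∪ midpoints (2/3) 1 l).Nonempty :=
    (midpoints_nonempty _ _ hk).mono Finset.subset_union_left
  refine (quantErr_le _ hne ((Finset.card_union_le _ _).trans
    ((add_le_add (card_midpoints_le _ _ _) (card_midpoints_le _ _ _)).trans h))).trans ?_
  rw [distortion_mix_eq_intervalCost hne]
  have h₁ := intervalCost_le_of_midpoints_subset (a := 0) (b := 1/3) (by norm_num) hk
    (Finset.subset_union_left (s₂ := midpoints (2/3) 1 l))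
  have h₂ := intervalCost_le_of_midpoints_subset (a := 2/3) (b := 1) (by norm_num) hl
    (Finset.subset_union_right (s₁ := midpoints 0 (1/3) k))
  have h₃ := add_le_add (mul_le_mul_of_nonneg_left h₁ (by norm_num : (0 : ℝ) ≤ 3 / 100))
    (mul_le_mul_of_nonneg_left h₂ (by norm_num : (0 : ℝ) ≤ 297 / 100))
  refine h₃.trans (le_of_eq ?_)
  have : (0 : ℝ) < k := by exact_mod_cast hk
  have : (0 : ℝ) < l := by exact_mod_cast hl
  field_simp
  ring

theorem le_intervalCost_of_right {γ : Finset ℝ} (hγ : γ.Nonempty) {a b t : ℝ} (hab : a ≤ b)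
    (hbt : b ≤ t) (h : ∀ c ∈ γ, t ≤ c) :
    ((t - a) ^ 3 - (t - b) ^ 3) / 3 ≤ intervalCost γ a b := by
  refine le_trans (le_of_eq ?_) (intervalCost_mono_of_le hγ (f := fun x => (x - t) ^ 2)
    (by fun_prop) fun x hx => le_sqDist hγ fun c hc => ?_)
  · rw [integral_Icc_eq hab, integral_sub_sq]
    ring
  · have h₁ := h c hc
    have h₂ := hx.2
    nlinarith

theorem le_intervalCost_of_left {γ : Finset ℝ} (hγ : γ.Nonempty) {a b t : ℝ} (hab : a ≤ b)
    (hta : t ≤ a) (h : ∀ c ∈ γ, c ≤ t) :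
    ((b - t) ^ 3 - (a - t) ^ 3) / 3 ≤ intervalCost γ a b := by
  refine le_trans (le_of_eq ?_) (intervalCost_mono_of_le hγ (f := fun x => (x - t) ^ 2)
    (by fun_prop) fun x hx => le_sqDist hγ fun c hc => ?_)
  · rw [integral_Icc_eq hab, integral_sub_sq]
  · have h₁ := h c hc
    have h₂ := hx.1
    nlinarith

theorem third_div_le {m : ℕ} {a b : ℝ} (hab : b - a = 1 / 3) (hm : 0 < m) :
    (b - a) / (2 * m) ≤ 1 / 6 := by
  have hm' : (1 : ℝ) ≤ m := by exact_mod_cast hm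
  rw [hab, div_le_div_iff₀ (by positivity) (by norm_num)]
  linarith

theorem exists_le_half_of_isOptimal {n : ℕ} (hn : 3 ≤ n) {γ : Finset ℝ}
    (hγ : IsOptimal (mix (1/100) (unif 0 (1/3)) (unif (2/3) 1)) n γ) :
    ∃ c ∈ γ, c ≤ 1 / 2 := by
  obtain ⟨hne, hcard, hopt⟩ := hγ
  rw [distortion_mix_eq_intervalCost hne] at hopt
  by_contra! hall
  have hub := quantErr_mix_le (k := 1) (l := n - 1) (n := n) one_pos (by omega) (by omega)
  rw [← hopt] at hub
  have h₁ := le_intervalCost_of_right hne (a := 0) (b := 1/3) (by norm_num) (by norm_num)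
    fun c hc => (hall c hc).le
  have h₂ := le_intervalCost hne (a := 2/3) (b := 1) (by norm_num) (by omega : 0 < n) hcard
    fun c hc => .inl hc
  have hn0 : (0 : ℝ) < 1 / (n : ℝ) ^ 2 := by positivity
  rcases hn.eq_or_lt with rfl | hn4
  · norm_num at hub h₁ h₂
    by_cases hex : ∃ c ∈ γ, c ≤ 53 / 100
    · obtain ⟨c, hc, hcle⟩ := hex
      have h₃ := le_intervalCost hne (a := 2/3) (b := 1) (S := γ.erase c) (m := 2)
        (by norm_num) (by norm_num) (by rw [Finset.card_erase_of_mem hc]; omega)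
        fun d hd => by
          by_cases hdc : d = c
          · right
            intro x hx
            have := hx.1
            subst hdc
            refine le_trans ?_ (le_abs_self _)
            norm_num at this ⊢
            linarith
          · exact .inl (Finset.mem_erase.2 ⟨hdc, hd⟩)
      norm_num at h₃
      linarith
    · push Not at hex
      have h₃ := le_intervalCost_of_right hne (a := 0) (b := 1/3) (by norm_num) (by norm_num)
        fun c hc => (hex c hc).le
      norm_num at h₃
      linarith
  · have hn4' : (3 : ℝ) ≤ ((n - 1 : ℕ) : ℝ) := by
      exact_mod_cast (by omega : 3 ≤ n - 1)
    have h₃ : 99 / ((n - 1 : ℕ) : ℝ) ^ 2 ≤ 11 := by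
      rw [div_le_iff₀ (by positivity)]
      nlinarith
    have h₄ : (0 : ℝ) ≤ intervalCost γ (2/3) 1 := le_trans (by positivity) h₂
    norm_num at hub h₁
    linarith

theorem exists_half_lt_of_isOptimal {n : ℕ} (hn : 3 ≤ n) {γ : Finset ℝ}
    (hγ : IsOptimal (mix (1/100) (unif 0 (1/3)) (unif (2/3) 1)) n γ) :
    ∃ c ∈ γ, 1 / 2 < c := by
  obtain ⟨hne, hcard, hopt⟩ := hγ
  rw [distortion_mix_eq_intervalCost hne] at hopt
  by_contra! hall
  have hub := quantErr_mix_le (k := 1) (l := 1) (n := n) one_pos one_pos (by omega)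
  rw [← hopt] at hub
  have h₁ := le_intervalCost_of_left hne (a := 2/3) (b := 1) (by norm_num) (by norm_num) hall
  have h₂ : 0 ≤ intervalCost γ 0 (1/3) :=
    integral_nonneg fun x => le_sqDist hne fun c _ => sq_nonneg (x - c)
  norm_num at hub h₁
  linarith

theorem isOptimal_of_subset {a b : ℝ} (hab : a < b) {γ δ : Finset ℝ} (hδ : δ.Nonempty)
    (hsub : δ ⊆ γ) (hmem : ∀ c ∈ δ, c ∈ Icc a b)
    (hfar : ∀ c ∈ γ, c ∉ δ → ∀ x ∈ Icc a b, b - a ≤ |x - c|)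
    (hcost : intervalCost γ a b ≤ (b - a) ^ 3 / (12 * (δ.card : ℝ) ^ 2)) :
    IsOptimal (unif a b) δ.card δ := by
  refine ⟨hδ, le_rfl, le_antisymm ?_ (quantErr_le _ hδ le_rfl)⟩
  have heq : intervalCost δ a b ≤ intervalCost γ a b := by
    refine intervalCost_mono_of_le (hδ.mono hsub) (continuous_sqDist hδ) fun x hx =>
      le_sqDist (hδ.mono hsub) fun c hc => ?_
    by_cases hcδ : c ∈ δ
    · exact sqDist_le hcδ x
    · obtain ⟨d, hd⟩ := hδ
      refine (sqDist_le hd x).trans (sq_le_sq.2 (le_trans ?_ (hfar c hc hcδ x hx)))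
      have := hmem d hd
      rw [abs_le]
      constructor <;> linarith [this.1, this.2, hx.1, hx.2]
  have hba : 0 < b - a := by linarith
  have hc : (0 : ℝ) < δ.card := by exact_mod_cast hδ.card_pos
  rw [distortion_unif _ hab, quantErr_unif_eq hab hδ.card_pos]
  calc (b - a)⁻¹ * intervalCost δ a b
      ≤ (b - a)⁻¹ * ((b - a) ^ 3 / (12 * (δ.card : ℝ) ^ 2)) := by
        gcongr
        exact heq.trans hcost
    _ = (b - a) ^ 2 / (12 * (δ.card : ℝ) ^ 2) := by field_simp

theorem stmt11 (n : ℕ) (hn : 3 ≤ n) (γ : Finset ℝ)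
    (hγ : IsOptimal (mix (1/100) (unif 0 (1/3)) (unif (2/3) 1)) n γ)
    (k : ℕ) (hk : k = (γ.filter (fun c => c ∈ Icc (0:ℝ) (1/3))).card) :
    1 ≤ k ∧ k ≤ n - 1 ∧
    (∃ γ₁ γ₂ : Finset ℝ, IsOptimal (unif 0 (1/3)) k γ₁ ∧
      IsOptimal (unif (2/3) 1) (n - k) γ₂ ∧ γ = γ₁ ∪ γ₂) ∧
    quantErr (mix (1/100) (unif 0 (1/3)) (unif (2/3) 1)) n
      = 1 / 10800 * (1 / (k : ℝ) ^ 2 + 99 / ((n : ℝ) - k) ^ 2) := by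
  have hA' := exists_le_half_of_isOptimal hn hγ
  have hB' := exists_half_lt_of_isOptimal hn hγ
  obtain ⟨hne, hcard, hopt⟩ := hγ
  rw [distortion_mix_eq_intervalCost hne] at hopt
  set A := γ.filter (fun c => c ≤ 1 / 2) with hAdef
  set B := γ.filter (fun c => ¬ c ≤ 1 / 2) with hBdef
  have hAne : A.Nonempty := hA'.imp fun c hc => Finset.mem_filter.2 hc
  have hBne : B.Nonempty := hB'.imp fun c hc => Finset.mem_filter.2 ⟨hc.1, not_le.2 hc.2⟩
  have hAB : A ∪ B = γ := Finset.filter_union_filter_not_eq _ _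
  have hcards : A.card + B.card = γ.card := Finset.card_filter_add_card_filter_not _
  have hApos := hAne.card_pos
  have hBpos := hBne.card_pos
  have hSA : ∀ c ∈ γ, c ∈ A ∨
      ∀ x ∈ Icc (0 : ℝ) (1/3), (1/3 - 0) / (2 * (A.card : ℝ)) ≤ |x - c| := by
    intro c hc
    rcases le_or_gt c (1 / 2) with h | h
    · exact .inl (Finset.mem_filter.2 ⟨hc, h⟩)
    · refine .inr fun x hx => (third_div_le (by norm_num) hApos).trans ?_
      rw [abs_sub_comm]
      exact le_trans (by linarith [hx.2]) (le_abs_self _)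
  have hSB : ∀ c ∈ γ, c ∈ B ∨
      ∀ x ∈ Icc (2/3 : ℝ) 1, (1 - 2/3) / (2 * (B.card : ℝ)) ≤ |x - c| := by
    intro c hc
    rcases le_or_gt c (1 / 2) with h | h
    · refine .inr fun x hx => (third_div_le (by norm_num) hBpos).trans ?_
      exact le_trans (by linarith [hx.1]) (le_abs_self _)
    · exact .inl (Finset.mem_filter.2 ⟨hc, not_le.2 h⟩)
  have hlA := le_intervalCost hne (by norm_num) hApos le_rfl hSA
  have hlB := le_intervalCost hne (by norm_num) hBpos le_rfl hSB
  have hA0 : (0 : ℝ) < A.card := by exact_mod_cast hApos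
  have hB0 : (0 : ℝ) < B.card := by exact_mod_cast hBpos
  have eA : (1/3 - 0 : ℝ) ^ 3 / (12 * (A.card : ℝ) ^ 2) = 1 / 324 * (1 / (A.card : ℝ) ^ 2) := by
    field_simp
    norm_num
  have eB : (1 - 2/3 : ℝ) ^ 3 / (12 * (B.card : ℝ) ^ 2) = 1 / 324 * (1 / (B.card : ℝ) ^ 2) := by
    field_simp
    norm_num
  have hub := quantErr_mix_le hApos hBpos (hcards.trans_le hcard)
  have e99 : 99 / (B.card : ℝ) ^ 2 = 99 * (1 / (B.card : ℝ) ^ 2) := by ring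
  have hBn : B.card = n - A.card := by
    by_contra hne'
    have hub' := quantErr_mix_le hApos (l := B.card + 1) (n := n) (by omega) (by omega)
    have e99' : 99 / ((B.card + 1 : ℕ) : ℝ) ^ 2 = 99 * (1 / ((B.card + 1 : ℕ) : ℝ) ^ 2) := by ring
    have hlt : 1 / ((B.card + 1 : ℕ) : ℝ) ^ 2 < 1 / (B.card : ℝ) ^ 2 := by
      push_cast
      gcongr
      linarith
    rw [eA] at hlA
    rw [eB] at hlB
    linarith
  have hcA : intervalCost γ 0 (1/3) ≤ (1/3 - 0 : ℝ) ^ 3 / (12 * (A.card : ℝ) ^ 2) := by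
    rw [eA]
    rw [eB] at hlB
    linarith
  have hcB : intervalCost γ (2/3) 1 ≤ (1 - 2/3 : ℝ) ^ 3 / (12 * (B.card : ℝ) ^ 2) := by
    rw [eB]
    rw [eA] at hlA
    linarith
  have hmA := mem_Icc_of_intervalCost_le hne (by norm_num) hApos le_rfl hSA hcA
  have hmB := mem_Icc_of_intervalCost_le hne (by norm_num) hBpos le_rfl hSB hcB
  have hkA : k = A.card := by
    rw [hk]
    congr 1
    ext c
    simp only [hAdef, Finset.mem_filter]
    refine and_congr_right fun hc => ⟨fun h => by linarith [h.2], fun h => ?_⟩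
    exact hmA c (Finset.mem_filter.2 ⟨hc, h⟩)
  have hBk : B.card = n - k := by rw [hkA, hBn]
  have hfarA : ∀ c ∈ γ, c ∉ A → ∀ x ∈ Icc (0 : ℝ) (1/3), (1/3 - 0 : ℝ) ≤ |x - c| := by
    intro c hc hcA x hx
    have hcB' : c ∈ B := (Finset.mem_union.1 (hAB ▸ hc)).resolve_left hcA
    rw [abs_sub_comm]
    exact le_trans (by linarith [hx.2, (hmB c hcB').1]) (le_abs_self _)
  have hfarB : ∀ c ∈ γ, c ∉ B → ∀ x ∈ Icc (2/3 : ℝ) 1, (1 - 2/3 : ℝ) ≤ |x - c| := by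
    intro c hc hcB x hx
    have hcA' : c ∈ A := (Finset.mem_union.1 (hAB ▸ hc)).resolve_right hcB
    exact le_trans (by linarith [hx.1, (hmA c hcA').2]) (le_abs_self _)
  refine ⟨by omega, by omega, ⟨A, B, ?_, ?_, hAB.symm⟩, ?_⟩
  · rw [hkA]
    exact isOptimal_of_subset (by norm_num) hAne (Finset.filter_subset _ _) hmA hfarA hcA
  · rw [← hBk]
    exact isOptimal_of_subset (by norm_num) hBne (Finset.filter_subset _ _) hmB hfarB hcB
  · have hcast : (n : ℝ) - k = B.card := by
      rw [hBk, Nat.cast_sub (by omega)]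
    rw [hcast, hkA]
    refine le_antisymm hub ?_
    rw [eA] at hlA
    rw [eB] at hlB
    linarith
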